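/- arXiv:1010.5384 — 4 statements merged into one kernel-verified Lean document; each statement's English description precedes it below -/
import Mathlib

section
/- The function h : ℝ³ → ℝ defined by h(a,b,t) = (1 − √(1−a²)·√(1−b²)·cos t)/(a² + b² + t²) (with √ the real square root) tends to 1/2 as (a,b,t) tends to (0,0,0) within the punctured set {(a,b,t) : (a,b,t) ≠ (0,0,0), |a| ≤ 1, |b| ≤ 1}; i.e. Tendsto h, along the filter of punctured neighborhoods of 0 restricted to |a| ≤ 1 and |b| ≤ 1, to the neighborhood filter of 1/2. -/
open Filter Topology

lemma sqrt_aux (a : ℝ) (ha : a ^ 2 ≤ 1) :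
    a ^ 2 / 2 ≤ 1 - Real.sqrt (1 - a ^ 2) ∧
    1 - Real.sqrt (1 - a ^ 2) ≤ a ^ 2 / 2 + (a ^ 2) ^ 2 / 2 ∧
    1 - Real.sqrt (1 - a ^ 2) ≤ a ^ 2 ∧ 1 - Real.sqrt (1 - a ^ 2) ≤ 1 := by
  have h0 := Real.sqrt_nonneg (1 - a ^ 2)
  have h1 := Real.sq_sqrt (show (0 : ℝ) ≤ 1 - a ^ 2 by linarith)
  have hx := sq_nonneg a
  generalize Real.sqrt (1 - a ^ 2) = u at *
  generalize a ^ 2 = x at *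
  have hu : u ≤ 1 := by nlinarith
  have hx' : x = 1 - u ^ 2 := by linarith
  subst hx'
  refine ⟨by nlinarith [sq_nonneg (1 - u)], ?_, by nlinarith, by linarith⟩
  nlinarith [mul_nonneg (mul_nonneg h0 (sq_nonneg (1 - u))) h0, mul_nonneg h0 (sq_nonneg (1 - u))]

lemma main_aux (x y z p q r : ℝ) (hx : 0 ≤ x) (hy : 0 ≤ y) (hz : 0 ≤ z)
    (hp : x / 2 ≤ p) (hp2 : p ≤ x / 2 + x ^ 2 / 2) (hp3 : p ≤ x) (hp4 : p ≤ 1)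
    (hq : y / 2 ≤ q) (hq2 : q ≤ y / 2 + y ^ 2 / 2) (hq3 : q ≤ y) (hq4 : q ≤ 1)
    (hr0 : 0 ≤ r) (hr : z / 2 - z ^ 2 ≤ r) (hr3 : r ≤ z / 2) (hr4 : r ≤ 1) :
    |1 - (1 - p) * (1 - q) * (1 - r) - (x + y + z) / 2| ≤ (x + y + z) ^ 2 := by
  have hp0 : 0 ≤ p := by linarith
  have hq0 : 0 ≤ q := by linarith
  have e1 : p * q ≤ x * y := by gcongr
  have e2 : p * r ≤ x * z := mul_le_mul hp3 (by linarith) hr0 hx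
  have e3 : q * r ≤ y * z := mul_le_mul hq3 (by linarith) hr0 hy
  have e4 : 0 ≤ p * q * r := by positivity
  have e5 : p * q * r ≤ p * q := mul_le_of_le_one_right (by positivity) hr4
  have e6 := mul_nonneg hp0 hr0
  have e7 := mul_nonneg hq0 hr0
  have := mul_nonneg hx hy
  have := mul_nonneg hx hz
  have := mul_nonneg hy hz
  rw [abs_le]
  constructor <;> nlinarith [sq_nonneg x, sq_nonneg y, sq_nonneg z]

theorem ratio_tendsto_half :
    Filter.Tendsto
      (fun p : ℝ × ℝ × ℝ =>
        (1 - Real.sqrt (1 - p.1 ^ 2) * Real.sqrt (1 - p.2.1 ^ 2) * Real.cos p.2.2) /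
          (p.1 ^ 2 + p.2.1 ^ 2 + p.2.2 ^ 2))
      (𝓝[{p : ℝ × ℝ × ℝ | p ≠ 0 ∧ |p.1| ≤ 1 ∧ |p.2.1| ≤ 1}] 0)
      (𝓝 (1 / 2)) := by
  have hS : Tendsto (fun p : ℝ × ℝ × ℝ => p.1 ^ 2 + p.2.1 ^ 2 + p.2.2 ^ 2)
      (𝓝[{p : ℝ × ℝ × ℝ | p ≠ 0 ∧ |p.1| ≤ 1 ∧ |p.2.1| ≤ 1}] 0) (𝓝 0) := by
    have : Continuous (fun p : ℝ × ℝ × ℝ => p.1 ^ 2 + p.2.1 ^ 2 + p.2.2 ^ 2) := by fun_prop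
    have h := this.tendsto 0
    simp at h
    exact h.mono_left nhdsWithin_le_nhds
  rw [tendsto_iff_dist_tendsto_zero]
  refine squeeze_zero' (Eventually.of_forall fun _ => dist_nonneg) ?_ hS
  filter_upwards [self_mem_nhdsWithin, hS.eventually (gt_mem_nhds one_pos)] with ⟨a, b, t⟩ hm hlt
  obtain ⟨hne, -, -⟩ := hm
  simp only at hlt ⊢
  have hpos : 0 < a ^ 2 + b ^ 2 + t ^ 2 := by
    by_contra hcon
    apply hne
    have ha : a = 0 := by nlinarith [sq_nonneg a, sq_nonneg b, sq_nonneg t]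
    have hb : b = 0 := by nlinarith [sq_nonneg a, sq_nonneg b, sq_nonneg t]
    have ht : t = 0 := by nlinarith [sq_nonneg a, sq_nonneg b, sq_nonneg t]
    simp [ha, hb, ht]
  have ha := sq_nonneg a
  have hb := sq_nonneg b
  have ht := sq_nonneg t
  obtain ⟨a1, a2, a3, a4⟩ := sqrt_aux a (by linarith)
  obtain ⟨b1, b2, b3, b4⟩ := sqrt_aux b (by linarith)
  have htl : |t| ≤ 1 := (sq_le_one_iff_abs_le_one t).1 (by linarith)
  have hc := (abs_le.1 (Real.cos_bound htl)).2
  have h4 : |t| ^ 4 = (t ^ 2) ^ 2 := by rw [← sq_abs t]; ring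
  rw [h4] at hc
  have hc1 := Real.one_sub_sq_div_two_le_cos (x := t)
  have key := main_aux (a ^ 2) (b ^ 2) (t ^ 2) _ _ (1 - Real.cos t) ha hb ht a1 a2 a3 a4 b1 b2 b3 b4
    (by linarith [Real.cos_le_one t]) (by nlinarith [sq_nonneg (t ^ 2)]) (by linarith) (by linarith)
  simp only [sub_sub_cancel] at key
  rw [Real.dist_eq, div_sub' hpos.ne', abs_div, abs_of_pos hpos, div_le_iff₀ hpos]
  rw [← pow_two, show ∀ N S : ℝ, N - S * (1 / 2) = N - S / 2 from fun N S => by ring]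
  exact key
end

section
/- Let σ be the canonical surface measure on the unit sphere S² ⊆ EuclideanSpace ℝ (Fin 3). For every measurable function F : EuclideanSpace ℝ (Fin 3) → [0,∞], ∫_{ℝ³} F(x)·(1+‖x‖²)^{−1/2} dx = ∫_{ε ∈ (0,1)} (√(1−ε²)/ε³) · ( ∫_{S²} F( (√(1−ε²)/ε)·ξ ) dσ(ξ) ) dε, where the left integral is with respect to Lebesgue measure on EuclideanSpace ℝ (Fin 3). -/
open MeasureTheory Metric ENNReal

theorem polar_lintegral_aux
    (G : EuclideanSpace ℝ (Fin 3) → ℝ≥0∞) (hG : Measurable G) :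
    ∫⁻ x, G x ∂volume =
      ∫⁻ r in Set.Ioi (0 : ℝ), ENNReal.ofReal (r ^ 2) *
        ∫⁻ ξ : sphere (0 : EuclideanSpace ℝ (Fin 3)) 1,
          G (r • (ξ : EuclideanSpace ℝ (Fin 3)))
          ∂(volume : Measure (EuclideanSpace ℝ (Fin 3))).toSphere := by
  have hmp := (volume : Measure (EuclideanSpace ℝ (Fin 3))).measurePreserving_homeomorphUnitSphereProd
  have hd : Module.finrank ℝ (EuclideanSpace ℝ (Fin 3)) - 1 = 2 := by simp
  rw [hd] at hmp
  have hm : Measurable (fun p : sphere (0 : EuclideanSpace ℝ (Fin 3)) 1 × Set.Ioi (0 : ℝ) =>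
      G ((p.2 : ℝ) • (p.1 : EuclideanSpace ℝ (Fin 3)))) := by
    apply hG.comp
    fun_prop
  have h1 := hmp.lintegral_comp hm
  have hm2 : Measurable (fun p : ℝ × sphere (0 : EuclideanSpace ℝ (Fin 3)) 1 =>
      G ((p.1 : ℝ) • (p.2 : EuclideanSpace ℝ (Fin 3)))) := by
    apply hG.comp
    fun_prop
  have hm3 := hm2.lintegral_prod_right'
    (ν := (volume : Measure (EuclideanSpace ℝ (Fin 3))).toSphere)
  calc ∫⁻ x, G x ∂volume
      = ∫⁻ x in ({0}ᶜ : Set (EuclideanSpace ℝ (Fin 3))), G x := by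
        rw [restrict_compl_singleton]
    _ = ∫⁻ x : ({0}ᶜ : Set (EuclideanSpace ℝ (Fin 3))), G x
          ∂(Measure.comap Subtype.val volume) := by
        rw [lintegral_subtype_comap (by measurability)]
    _ = _ := by
        rw [← lintegral_subtype_comap measurableSet_Ioi]
        rw [lintegral_prod_symm _ hm.aemeasurable] at h1
        refine Eq.trans ?_ (h1.trans (lintegral_withDensity_eq_lintegral_mul _ (by fun_prop)
          (hm3.comp measurable_subtype_coe)))
        refine lintegral_congr fun x => ?_
        have hx : ‖(x : EuclideanSpace ℝ (Fin 3))‖ ≠ 0 := norm_ne_zero_iff.2 x.2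
        simp [smul_smul, hx]

theorem hyperboloid_measure_spherical_coordinates
    (σ : Measure (sphere (0 : EuclideanSpace ℝ (Fin 3)) 1))
    (hσ : σ = (volume : Measure (EuclideanSpace ℝ (Fin 3))).toSphere)
    (F : EuclideanSpace ℝ (Fin 3) → ℝ≥0∞) (hF : Measurable F) :
    ∫⁻ x, F x * ENNReal.ofReal ((1 + ‖x‖ ^ 2) ^ (-(1 : ℝ) / 2)) ∂volume =
      ∫⁻ ε in Set.Ioo (0 : ℝ) 1,
        ENNReal.ofReal (Real.sqrt (1 - ε ^ 2) / ε ^ 3) *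
          ∫⁻ ξ : sphere (0 : EuclideanSpace ℝ (Fin 3)) 1,
            F ((Real.sqrt (1 - ε ^ 2) / ε) • (ξ : EuclideanSpace ℝ (Fin 3))) ∂σ
        ∂volume := by
  subst hσ
  have hpos : ∀ ε ∈ Set.Ioo (0 : ℝ) 1, 0 < 1 - ε ^ 2 := fun ε h => by nlinarith [h.1, h.2]
  have hinv : ∀ ε ∈ Set.Ioo (0 : ℝ) 1, 1 + (√(1 - ε ^ 2) / ε) ^ 2 = (ε ^ 2)⁻¹ := fun ε h => by
    have := h.1.ne'
    rw [div_pow, Real.sq_sqrt (hpos ε h).le]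
    field_simp
    ring
  have himg : (fun ε : ℝ => √(1 - ε ^ 2) / ε) '' Set.Ioo (0 : ℝ) 1 = Set.Ioi 0 := by
    ext r
    constructor
    · rintro ⟨ε, h, rfl⟩
      exact div_pos (Real.sqrt_pos.2 (hpos ε h)) h.1
    · intro (hr : 0 < r)
      have hs : 0 < √(1 + r ^ 2) := Real.sqrt_pos.2 (by positivity)
      refine ⟨(√(1 + r ^ 2))⁻¹, ⟨by positivity, ?_⟩, ?_⟩
      · apply inv_lt_one_of_one_lt₀
        rw [Real.lt_sqrt] <;> nlinarith
      · have h : 1 - ((√(1 + r ^ 2))⁻¹) ^ 2 = (r / √(1 + r ^ 2)) ^ 2 := by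
          rw [inv_pow, div_pow, Real.sq_sqrt (by positivity)]
          field_simp
          ring
        simp only [h]
        rw [Real.sqrt_sq (by positivity)]
        field_simp
  have hinj : Set.InjOn (fun ε : ℝ => √(1 - ε ^ 2) / ε) (Set.Ioo (0 : ℝ) 1) := by
    intro a ha b hb hab
    have h1 := hinv a ha
    have h2 := hinv b hb
    simp only at hab
    rw [hab, h2, inv_inj] at h1
    exact ((pow_left_inj₀ hb.1.le ha.1.le two_ne_zero).1 h1).symm
  have hder : ∀ ε ∈ Set.Ioo (0 : ℝ) 1, HasDerivWithinAt (fun ε : ℝ => √(1 - ε ^ 2) / ε)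
      (-(1 / (ε ^ 2 * √(1 - ε ^ 2)))) (Set.Ioo (0 : ℝ) 1) ε := by
    intro ε h
    have hp := hpos ε h
    have hs := Real.sqrt_pos.2 hp
    have he := h.1.ne'
    have hq : HasDerivAt (fun ε : ℝ => 1 - ε ^ 2) (-(2 * ε)) ε := by
      simpa using (hasDerivAt_pow 2 ε).const_sub 1
    have := ((hq.sqrt hp.ne').fun_div (hasDerivAt_id' ε) he).hasDerivWithinAt
      (s := Set.Ioo (0 : ℝ) 1)
    refine this.congr_deriv ?_
    have h2 := Real.sq_sqrt hp.le
    field_simp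
    rw [h2]
    ring
  have hmw : Measurable (fun x : EuclideanSpace ℝ (Fin 3) =>
      F x * ENNReal.ofReal ((1 + ‖x‖ ^ 2) ^ (-(1 : ℝ) / 2))) := by fun_prop
  rw [polar_lintegral_aux _ hmw, ← himg,
    lintegral_image_eq_lintegral_abs_deriv_mul measurableSet_Ioo hder hinj]
  refine setLIntegral_congr_fun measurableSet_Ioo fun ε h => ?_
  have he := h.1
  have hs := Real.sqrt_pos.2 (hpos ε h)
  have hw : ((ε ^ 2)⁻¹ : ℝ) ^ (-(1 : ℝ) / 2) = ε := by
    rw [Real.inv_rpow (by positivity), ← Real.rpow_neg (by positivity), ← Real.rpow_natCast,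
      ← Real.rpow_mul he.le]
    norm_num
  have hn : ∀ ξ : sphere (0 : EuclideanSpace ℝ (Fin 3)) 1,
      ‖(√(1 - ε ^ 2) / ε) • (ξ : EuclideanSpace ℝ (Fin 3))‖ = √(1 - ε ^ 2) / ε := fun ξ => by
    rw [norm_smul, norm_eq_of_mem_sphere, mul_one, Real.norm_of_nonneg (by positivity)]
  simp only [hn, hinv ε h, hw]
  rw [lintegral_mul_const' _ _ ENNReal.ofReal_ne_top, abs_neg, abs_of_pos (by positivity),
    mul_comm (lintegral _ _), ← mul_assoc, ← mul_assoc, ← ENNReal.ofReal_mul (by positivity),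
    ← ENNReal.ofReal_mul (by positivity)]
  congr 2
  field_simp
end

section
/- Fix n ≥ 0, exponents κ : Fin (n+1) → ℝ, a finite index type J with maps a, b, c : J → Fin (n+1) and p : J → ℝ with p j > 0 for all j, and let f : (Fin (n+1) → ℝ) → ℝ be f(y) = (∏_{α} (y α)^{κ α}) · ∏_{j ∈ J} ((y (a j))² + (y (b j))² + (y (c j))²)^{−p j}. Let λ = κ 0 − 2·∑_{j : a j = 0 ∧ b j = 0 ∧ c j = 0} p j. If λ + 1 > 0, then for every C > 0 there exist constants c₁, c₂ > 0 such that for every y : Fin (n+1) → ℝ with y α > 0 for all α and y 0 ≤ y α for all α ≠ 0: c₁ · f(y) · (y 0) ≤ ∫_{z₀ ∈ (0, C·(y 0))} f(Function.update y 0 z₀) dz₀ ≤ c₂ · f(y) · (y 0). -/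
open Finset MeasureTheory

theorem psi_factor_bound {n : ℕ} (i j k : Fin (n + 1)) (p : ℝ) (hp : 0 < p) (C : ℝ)
    (hC : 0 < C) (y : Fin (n + 1) → ℝ) (hy : ∀ α, 0 < y α) (hy0 : ∀ α, α ≠ 0 → y 0 ≤ y α)
    (t : ℝ) (ht : 0 < t) (htC : t < C) (w : Fin (n + 1) → ℝ)
    (hw : w = Function.update y 0 (t * y 0)) :
    (3 + C ^ 2) ^ (-p) * (t ^ (if i = 0 ∧ j = 0 ∧ k = 0 then -(2 * p) else 0) *
      ((y i) ^ 2 + (y j) ^ 2 + (y k) ^ 2) ^ (-p)) ≤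
      ((w i) ^ 2 + (w j) ^ 2 + (w k) ^ 2) ^ (-p) ∧
    ((w i) ^ 2 + (w j) ^ 2 + (w k) ^ 2) ^ (-p) ≤
    (3 + C ^ 2) ^ p * (t ^ (if i = 0 ∧ j = 0 ∧ k = 0 then -(2 * p) else 0) *
      ((y i) ^ 2 + (y j) ^ 2 + (y k) ^ 2) ^ (-p)) := by
  have hC2 : 0 < C ^ 2 := by positivity
  have hw0 : w 0 = t * y 0 := by simp [hw]
  have hwn : ∀ α, α ≠ 0 → w α = y α := fun α h => by simp [hw, h]
  have hwpos : ∀ α, 0 < w α := by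
    intro α
    by_cases h : α = 0
    · subst h; rw [hw0]; exact mul_pos ht (hy 0)
    · rw [hwn α h]; exact hy α
  have hSy : 0 < (y i) ^ 2 + (y j) ^ 2 + (y k) ^ 2 := by
    have := hy i; positivity
  have hSw : 0 < (w i) ^ 2 + (w j) ^ 2 + (w k) ^ 2 := by
    have := hwpos i; positivity
  split_ifs with h
  · obtain ⟨rfl, rfl, rfl⟩ := h
    have e : (w 0) ^ 2 + (w 0) ^ 2 + (w 0) ^ 2 = t ^ 2 * ((y 0) ^ 2 + (y 0) ^ 2 + (y 0) ^ 2) := by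
      rw [hw0]; ring
    have e2 : ((w 0) ^ 2 + (w 0) ^ 2 + (w 0) ^ 2) ^ (-p) =
        t ^ (-(2 * p)) * ((y 0) ^ 2 + (y 0) ^ 2 + (y 0) ^ 2) ^ (-p) := by
      rw [e, Real.mul_rpow (by positivity) hSy.le]
      congr 1
      rw [← Real.rpow_natCast, ← Real.rpow_mul ht.le]
      congr 1; push_cast; ring
    rw [e2]
    set X := t ^ (-(2 * p)) * ((y 0) ^ 2 + (y 0) ^ 2 + (y 0) ^ 2) ^ (-p)
    have hX : 0 ≤ X := by positivity
    have h1 : (3 + C ^ 2) ^ (-p) ≤ 1 :=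
      Real.rpow_le_one_of_one_le_of_nonpos (by linarith) (by linarith)
    have h2 : 1 ≤ (3 + C ^ 2) ^ p := Real.one_le_rpow (by linarith) hp.le
    exact ⟨mul_le_of_le_one_left hX h1, le_mul_of_one_le_left hX h2⟩
  · simp only [Real.rpow_zero, one_mul]
    have up : ∀ α, (w α) ^ 2 ≤ (3 + C ^ 2) * (y α) ^ 2 := by
      intro α
      have := sq_nonneg (y α)
      by_cases h : α = 0
      · subst h; rw [hw0, mul_pow]
        have : t ^ 2 ≤ 3 + C ^ 2 := by nlinarith
        gcongr
      · rw [hwn α h]; nlinarith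
    have hle : (w i) ^ 2 + (w j) ^ 2 + (w k) ^ 2 ≤
        (3 + C ^ 2) * ((y i) ^ 2 + (y j) ^ 2 + (y k) ^ 2) := by
      linarith [up i, up j, up k]
    have h0 : (y 0) ^ 2 ≤ (w i) ^ 2 + (w j) ^ 2 + (w k) ^ 2 := by
      have key : ∀ α, α ≠ 0 → (y 0) ^ 2 ≤ (w α) ^ 2 := fun α h => by
        rw [hwn α h]; exact pow_le_pow_left₀ (hy 0).le (hy0 α h) 2
      have := sq_nonneg (w i)
      have := sq_nonneg (w j)
      have := sq_nonneg (w k)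
      by_cases hi : i = 0
      · by_cases hj : j = 0
        · have hk : k ≠ 0 := fun hk => h ⟨hi, hj, hk⟩
          linarith [key k hk]
        · linarith [key j hj]
      · linarith [key i hi]
    have lo : ∀ α, (y α) ^ 2 ≤ (w α) ^ 2 ∨ (y α) ^ 2 ≤ (w i) ^ 2 + (w j) ^ 2 + (w k) ^ 2 := by
      intro α
      by_cases h : α = 0
      · subst h; exact Or.inr h0
      · left; rw [hwn α h]
    have hge : (y i) ^ 2 + (y j) ^ 2 + (y k) ^ 2 ≤
        (3 + C ^ 2) * ((w i) ^ 2 + (w j) ^ 2 + (w k) ^ 2) := by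
      have := sq_nonneg (w i)
      have := sq_nonneg (w j)
      have := sq_nonneg (w k)
      have : 0 ≤ C ^ 2 * ((w i) ^ 2 + (w j) ^ 2 + (w k) ^ 2) := by positivity
      rcases lo i with h1 | h1 <;> rcases lo j with h2 | h2 <;> rcases lo k with h3 | h3 <;>
        linarith
    constructor
    · rw [← Real.mul_rpow (by positivity) hSy.le]
      exact Real.rpow_le_rpow_of_nonpos hSw hle (by linarith)
    · have := Real.rpow_le_rpow_of_nonpos hSy hge (show -p ≤ 0 by linarith)
      rw [Real.mul_rpow (by positivity) hSw.le] at this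
      have h3 : (3 + C ^ 2) ^ p * (3 + C ^ 2) ^ (-p) = 1 := by
        rw [← Real.rpow_add (by positivity)]; simp
      calc _ = (3 + C ^ 2) ^ p * ((3 + C ^ 2) ^ (-p) *
            ((w i) ^ 2 + (w j) ^ 2 + (w k) ^ 2) ^ (-p)) := by rw [← mul_assoc, h3, one_mul]
        _ ≤ _ := by gcongr

theorem psi_class_integral_estimate {n : ℕ} (κ : Fin (n + 1) → ℝ) {J : Type*} [Fintype J]
    (a b c : J → Fin (n + 1)) (p : J → ℝ) (hp : ∀ j, 0 < p j)
    (f : (Fin (n + 1) → ℝ) → ℝ)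
    (hf : f = fun y => (∏ α, y α ^ κ α) *
      ∏ j, ((y (a j)) ^ 2 + (y (b j)) ^ 2 + (y (c j)) ^ 2) ^ (-(p j)))
    (lam : ℝ)
    (hlam : lam = κ 0 -
      2 * ∑ j ∈ Finset.univ.filter (fun j => a j = 0 ∧ b j = 0 ∧ c j = 0), p j)
    (hpos : 0 < lam + 1) :
    ∀ C : ℝ, 0 < C → ∃ c₁ c₂ : ℝ, 0 < c₁ ∧ 0 < c₂ ∧
      ∀ y : Fin (n + 1) → ℝ, (∀ α, 0 < y α) → (∀ α, α ≠ 0 → y 0 ≤ y α) →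
        c₁ * (f y * y 0) ≤ (∫ z₀ in Set.Ioo 0 (C * y 0), f (Function.update y 0 z₀)) ∧
        (∫ z₀ in Set.Ioo 0 (C * y 0), f (Function.update y 0 z₀)) ≤ c₂ * (f y * y 0) := by
  intro C hC
  have hfm : Measurable f := by
    rw [hf]; fun_prop
  set m : ℝ := ∏ j, (3 + C ^ 2) ^ (-(p j)) with hm
  set M : ℝ := ∏ j, (3 + C ^ 2) ^ (p j) with hM
  have hmpos : 0 < m := Finset.prod_pos fun j _ => by positivity
  have hMpos : 0 < M := Finset.prod_pos fun j _ => by positivity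
  set I : ℝ := C ^ (lam + 1) / (lam + 1) with hI
  have hIpos : 0 < I := by positivity
  refine ⟨m * I, M * I, by positivity, by positivity, ?_⟩
  intro y hy hy0
  have hy00 := hy 0
  -- pointwise bound
  have pt : ∀ z ∈ Set.Ioo 0 (C * y 0),
      m * f y * (y 0) ^ (-lam) * z ^ lam ≤ f (Function.update y 0 z) ∧
      f (Function.update y 0 z) ≤ M * f y * (y 0) ^ (-lam) * z ^ lam := by
    intro z hz
    obtain ⟨t, rfl⟩ : ∃ t, z = t * y 0 := ⟨z / y 0, by field_simp⟩
    have ht : 0 < t := pos_of_mul_pos_left hz.1 hy00.le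
    have htC : t < C := lt_of_mul_lt_mul_right hz.2 hy00.le
    have B := fun j => psi_factor_bound (a j) (b j) (c j) (p j) (hp j) C hC y hy hy0 t ht htC
      (Function.update y 0 (t * y 0)) rfl
    have e1 : (y 0) ^ (-lam) * (t * y 0) ^ lam = t ^ lam := by
      rw [Real.mul_rpow ht.le hy00.le, mul_left_comm, ← Real.rpow_add hy00]; simp
    have e2 : ∏ α, (Function.update y 0 (t * y 0) α) ^ κ α = t ^ κ 0 * ∏ α, y α ^ κ α := by
      rw [Fin.prod_univ_succ, Fin.prod_univ_succ (fun α => y α ^ κ α)]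
      simp [Fin.succ_ne_zero, Real.mul_rpow ht.le hy00.le, mul_assoc]
    have e3 : t ^ lam = t ^ κ 0 *
        ∏ j, t ^ (if a j = 0 ∧ b j = 0 ∧ c j = 0 then -(2 * p j) else 0) := by
      rw [← Real.rpow_sum_of_pos ht, ← Real.rpow_add ht, hlam, Finset.mul_sum,
        Finset.sum_filter, sub_eq_add_neg, ← Finset.sum_neg_distrib]
      congr 2
      refine Finset.sum_congr rfl fun j _ => ?_
      split_ifs <;> simp
    have hA : 0 ≤ t ^ κ 0 * ∏ α, y α ^ κ α :=
      mul_nonneg (by positivity) (Finset.prod_nonneg fun α _ => Real.rpow_nonneg (hy α).le _)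
    rw [mul_assoc _ ((y 0) ^ (-lam)), mul_assoc _ ((y 0) ^ (-lam)), e1, e3]
    simp only [hf, e2]
    constructor
    · refine le_trans (le_of_eq ?_) (mul_le_mul_of_nonneg_left
        (Finset.prod_le_prod (fun j _ => ?_) (fun j _ => (B j).1)) hA)
      · rw [Finset.prod_mul_distrib, Finset.prod_mul_distrib]; ring
      · positivity
    · refine le_trans (mul_le_mul_of_nonneg_left
        (Finset.prod_le_prod (fun j _ => ?_) (fun j _ => (B j).2)) hA) (le_of_eq ?_)
      · positivity
      · rw [Finset.prod_mul_distrib, Finset.prod_mul_distrib]; ring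
  have hfy : 0 ≤ f y := by
    rw [hf]
    exact mul_nonneg (Finset.prod_nonneg fun α _ => Real.rpow_nonneg (hy α).le _)
      (Finset.prod_nonneg fun j _ => by positivity)
  have hint0 : IntegrableOn (fun z : ℝ => z ^ lam) (Set.Ioo 0 (C * y 0)) :=
    (intervalIntegral.integrableOn_Ioo_rpow_iff (by positivity)).2 (by linarith)
  have hval : ∫ z in Set.Ioo 0 (C * y 0), z ^ lam = I * (y 0) ^ (lam + 1) := by
    rw [← integral_Ioc_eq_integral_Ioo, ← intervalIntegral.integral_of_le (by positivity),
      integral_rpow (Or.inl (by linarith)), Real.zero_rpow hpos.ne',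
      Real.mul_rpow hC.le hy00.le, hI]
    ring
  have hval2 : ∀ X : ℝ, ∫ z in Set.Ioo 0 (C * y 0), X * f y * (y 0) ^ (-lam) * z ^ lam =
      X * I * (f y * y 0) := by
    intro X
    rw [integral_const_mul, hval]
    have : (y 0) ^ (-lam) * (y 0) ^ (lam + 1) = y 0 := by
      rw [← Real.rpow_add hy00]; simp
    linear_combination X * f y * I * this
  have hintX : ∀ X : ℝ, IntegrableOn (fun z : ℝ => X * f y * (y 0) ^ (-lam) * z ^ lam)
      (Set.Ioo 0 (C * y 0)) := fun X => hint0.const_mul _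
  have hintf : IntegrableOn (fun z => f (Function.update y 0 z)) (Set.Ioo 0 (C * y 0)) := by
    refine Integrable.mono' (hintX M)
      (hfm.comp (measurable_update y)).aestronglyMeasurable ?_
    refine (ae_restrict_iff' measurableSet_Ioo).2 (Filter.Eventually.of_forall fun z hz => ?_)
    have hz0 : 0 < z := hz.1
    rw [Real.norm_of_nonneg (le_trans (by positivity) (pt z hz).1)]
    exact (pt z hz).2
  constructor
  · rw [← hval2 m]
    exact setIntegral_mono_on (hintX m) hintf measurableSet_Ioo fun z hz => (pt z hz).1
  · rw [← hval2 M]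
    exact setIntegral_mono_on hintf (hintX M) measurableSet_Ioo fun z hz => (pt z hz).2
end

section
/- For every g in the special linear group SL(2, ℂ) (2×2 complex matrices of determinant 1), there exist matrices u, v in SU(2) (2×2 unitary matrices of determinant 1) and a unique r ≥ 0 such that g = u * (diagonal matrix with entries e^{r/2}, e^{−r/2}) * v; moreover this r satisfies cosh r = (1/2)·Re( trace (g * gᴴ) ), where gᴴ is the conjugate transpose of g. -/
open Matrix

lemma cartan_cosh (A u v : Matrix (Fin 2) (Fin 2) ℂ) (r : ℝ)
    (hu : u ∈ Matrix.specialUnitaryGroup (Fin 2) ℂ)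
    (hv : v ∈ Matrix.specialUnitaryGroup (Fin 2) ℂ)
    (h : A = u * Matrix.diagonal ![(Real.exp (r / 2) : ℂ), (Real.exp (-r / 2) : ℂ)] * v) :
    Real.cosh r = (1 / 2) * (Matrix.trace (A * Aᴴ)).re := by
  have hu1 : uᴴ * u = 1 := (Matrix.mem_unitaryGroup_iff'.1 (Matrix.mem_specialUnitaryGroup_iff.1 hu).1)
  have hv1 : v * vᴴ = 1 := (Matrix.mem_unitaryGroup_iff.1 (Matrix.mem_specialUnitaryGroup_iff.1 hv).1)
  set D := Matrix.diagonal ![(Real.exp (r / 2) : ℂ), (Real.exp (-r / 2) : ℂ)] with hD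
  have e : A * Aᴴ = u * (D * Dᴴ * uᴴ) := by
    rw [h]
    simp only [Matrix.conjTranspose_mul]
    calc u * D * v * (vᴴ * (Dᴴ * uᴴ)) = u * D * (v * vᴴ) * (Dᴴ * uᴴ) := by
          simp only [Matrix.mul_assoc]
      _ = _ := by rw [hv1]; simp only [Matrix.mul_assoc, Matrix.mul_one]
  rw [e, Matrix.trace_mul_comm, Matrix.mul_assoc, hu1, Matrix.mul_one, hD,
    Matrix.diagonal_conjTranspose, Matrix.diagonal_mul_diagonal, Matrix.trace_diagonal,
    Real.cosh_eq]
  simp only [Fin.sum_univ_two, Pi.star_apply, Matrix.cons_val_zero, Matrix.cons_val_one,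
    RCLike.star_def, Complex.conj_ofReal, ← Complex.ofReal_mul, ← Complex.ofReal_add,
    Complex.ofReal_re, ← Real.exp_add]
  ring_nf

open scoped ComplexOrder in
lemma cartan_diag (H : Matrix (Fin 2) (Fin 2) ℂ) (hH : H.PosDef) (hd : H.det = 1) :
    ∃ (W : Matrix (Fin 2) (Fin 2) ℂ) (a b : ℝ), W ∈ Matrix.specialUnitaryGroup (Fin 2) ℂ ∧
      b ≤ a ∧ 0 < a ∧ a * b = 1 ∧ Wᴴ * H * W = Matrix.diagonal ![(a : ℂ), (b : ℂ)] := by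
  have key : ∃ (W : Matrix (Fin 2) (Fin 2) ℂ) (a b : ℝ),
      W ∈ Matrix.specialUnitaryGroup (Fin 2) ℂ ∧
      0 < a ∧ a * b = 1 ∧ Wᴴ * H * W = Matrix.diagonal ![(a : ℂ), (b : ℂ)] := by
    have hh := hH.isHermitian
    let U : Matrix (Fin 2) (Fin 2) ℂ := hh.eigenvectorUnitary
    have hU : U ∈ Matrix.unitaryGroup (Fin 2) ℂ := hh.eigenvectorUnitary.2
    have hU1 : Uᴴ * U = 1 := Matrix.mem_unitaryGroup_iff'.1 hU
    have hdU : star U.det * U.det = 1 := by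
      rw [← Matrix.det_conjTranspose, ← Matrix.det_mul, hU1, Matrix.det_one]
    have hdU2 : U.det * star U.det = 1 := by rw [mul_comm]; exact hdU
    have hs : Uᴴ * H * U = Matrix.diagonal (RCLike.ofReal ∘ hh.eigenvalues) := by
      have h1 := hh.spectral_theorem
      rw [Unitary.conjStarAlgAut_apply] at h1
      have h2 : H = U * Matrix.diagonal (RCLike.ofReal ∘ hh.eigenvalues) * Uᴴ := h1
      calc Uᴴ * H * U = Uᴴ * (U * Matrix.diagonal (RCLike.ofReal ∘ hh.eigenvalues) * Uᴴ) * U := by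
            rw [← h2]
        _ = (Uᴴ * U) * Matrix.diagonal (RCLike.ofReal ∘ hh.eigenvalues) * (Uᴴ * U) := by
            simp only [Matrix.mul_assoc]
        _ = _ := by rw [hU1, Matrix.one_mul, Matrix.mul_one]
    let P : Matrix (Fin 2) (Fin 2) ℂ := Matrix.diagonal ![star U.det, 1]
    have hP : P ∈ Matrix.unitaryGroup (Fin 2) ℂ := by
      rw [Matrix.mem_unitaryGroup_iff]
      ext i j
      fin_cases i <;> fin_cases j <;>
        simp [P, Matrix.mul_apply, Matrix.star_apply, Matrix.diagonal] 
      simpa using hdU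
    refine ⟨U * P, hh.eigenvalues 0, hh.eigenvalues 1, ?_, hH.eigenvalues_pos 0, ?_, ?_⟩
    · rw [Matrix.mem_specialUnitaryGroup_iff]
      refine ⟨mul_mem hU hP, ?_⟩
      rw [Matrix.det_mul, Matrix.det_diagonal]
      simpa using hdU2
    · have := hh.det_eq_prod_eigenvalues
      rw [hd, Fin.prod_univ_two] at this
      have h2 : ((hh.eigenvalues 0 * hh.eigenvalues 1 : ℝ) : ℂ) = 1 := by
        rw [Complex.ofReal_mul]; exact this.symm
      exact_mod_cast h2
    · rw [Matrix.conjTranspose_mul]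
      calc Pᴴ * Uᴴ * H * (U * P) = Pᴴ * (Uᴴ * H * U) * P := by simp only [Matrix.mul_assoc]
        _ = _ := by
          rw [hs, Matrix.diagonal_conjTranspose, Matrix.diagonal_mul_diagonal,
            Matrix.diagonal_mul_diagonal]
          congr 1
          ext i
          fin_cases i
          · have : U.det * (hh.eigenvalues 0 : ℂ) * star U.det = hh.eigenvalues 0 := by
              rw [mul_right_comm, hdU2, one_mul]
            simpa using this
          · simp
  obtain ⟨W, a, b, hW, ha, hab, hD⟩ := key
  rcases le_total b a with h | h
  · exact ⟨W, a, b, hW, h, ha, hab, hD⟩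
  · have hJ : (!![0, -1; 1, 0] : Matrix (Fin 2) (Fin 2) ℂ) ∈
        Matrix.specialUnitaryGroup (Fin 2) ℂ := by
      rw [Matrix.mem_specialUnitaryGroup_iff, Matrix.mem_unitaryGroup_iff]
      refine ⟨?_, by simp [Matrix.det_fin_two]⟩
      ext i j
      fin_cases i <;> fin_cases j <;> simp [Matrix.mul_apply, Matrix.star_apply]
    refine ⟨W * !![0, -1; 1, 0], b, a, mul_mem hW hJ, h, by linarith, by linarith, ?_⟩
    rw [Matrix.conjTranspose_mul]
    calc (!![0, -1; 1, 0] : Matrix (Fin 2) (Fin 2) ℂ)ᴴ * Wᴴ * H * (W * !![0, -1; 1, 0])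
        = (!![0, -1; 1, 0] : Matrix (Fin 2) (Fin 2) ℂ)ᴴ * (Wᴴ * H * W) * !![0, -1; 1, 0] := by
          simp only [Matrix.mul_assoc]
      _ = _ := by
        rw [hD]
        ext i j
        fin_cases i <;> fin_cases j <;>
          simp [Matrix.mul_apply, Matrix.conjTranspose_apply, Matrix.diagonal]

open scoped ComplexOrder in
lemma cartan_exists (g : Matrix (Fin 2) (Fin 2) ℂ) (hg : g.det = 1) :
    ∃ r : ℝ, 0 ≤ r ∧ ∃ u v : Matrix (Fin 2) (Fin 2) ℂ,
        u ∈ Matrix.specialUnitaryGroup (Fin 2) ℂ ∧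
        v ∈ Matrix.specialUnitaryGroup (Fin 2) ℂ ∧
        g = u * Matrix.diagonal ![(Real.exp (r / 2) : ℂ), (Real.exp (-r / 2) : ℂ)] * v := by
  have hinj : Function.Injective g.vecMul :=
    Matrix.vecMul_injective_of_isUnit ((Matrix.isUnit_iff_isUnit_det g).2 (by simp [hg]))
  have hpd : (g * gᴴ).PosDef := Matrix.PosDef.mul_conjTranspose_self g hinj
  obtain ⟨W, a, b, hW, hba, ha, hab, hD⟩ := cartan_diag (g * gᴴ) hpd (by
    rw [Matrix.det_mul, Matrix.det_conjTranspose, hg]; simp)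
  have hW1 : W * Wᴴ = 1 := Matrix.mem_unitaryGroup_iff.1 (Matrix.mem_specialUnitaryGroup_iff.1 hW).1
  have hWd : W.det = 1 := (Matrix.mem_specialUnitaryGroup_iff.1 hW).2
  have ha1 : 1 ≤ a := by nlinarith
  obtain ⟨r, rfl⟩ : ∃ r, a = Real.exp r := ⟨Real.log a, (Real.exp_log ha).symm⟩
  have hr : 0 ≤ r := by simpa using ha1
  have hb : b = Real.exp (-r) := by
    rw [Real.exp_neg]; exact eq_inv_of_mul_eq_one_right hab
  subst hb
  let D := Matrix.diagonal ![(Real.exp (r / 2) : ℂ), (Real.exp (-r / 2) : ℂ)]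
  let E := Matrix.diagonal ![(Real.exp (-r / 2) : ℂ), (Real.exp (r / 2) : ℂ)]
  have hx : Real.exp (r / 2) * Real.exp (-r / 2) = 1 := by
    rw [← Real.exp_add]; ring_nf; simp
  have hxc : (Real.exp (r / 2) : ℂ) * (Real.exp (-r / 2) : ℂ) = 1 := by exact_mod_cast hx
  have hDE : D * E = 1 := by
    rw [Matrix.diagonal_mul_diagonal, ← Matrix.diagonal_one]
    congr 1
    ext i
    fin_cases i
    · exact hxc
    · exact (mul_comm _ _).trans hxc
  have hEd : E.det = 1 := by
    rw [Matrix.det_diagonal, Fin.prod_univ_two]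
    exact (mul_comm _ _).trans hxc
  have hE : E * Matrix.diagonal ![(Real.exp r : ℂ), (Real.exp (-r) : ℂ)] * Eᴴ = 1 := by
    rw [Matrix.diagonal_conjTranspose, Matrix.diagonal_mul_diagonal,
      Matrix.diagonal_mul_diagonal, ← Matrix.diagonal_one]
    congr 1
    ext i
    fin_cases i
    · simp only [Fin.zero_eta, Pi.star_apply, Matrix.cons_val_zero, RCLike.star_def,
        Complex.conj_ofReal, ← Complex.ofReal_mul, ← Real.exp_add]
      ring_nf; simp
    · change (Real.exp (r / 2) : ℂ) * (Real.exp (-r) : ℂ) * star (Real.exp (r / 2) : ℂ) = 1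
      simp only [RCLike.star_def,
        Complex.conj_ofReal, ← Complex.ofReal_mul, ← Real.exp_add]
      ring_nf; simp
  refine ⟨r, hr, W, E * Wᴴ * g, hW, ?_, ?_⟩
  · rw [Matrix.mem_specialUnitaryGroup_iff, Matrix.mem_unitaryGroup_iff,
      Matrix.star_eq_conjTranspose]
    constructor
    · rw [← hE, ← hD]
      simp only [Matrix.conjTranspose_mul, Matrix.conjTranspose_conjTranspose, Matrix.mul_assoc]
    · rw [Matrix.det_mul, Matrix.det_mul, hEd, hg, Matrix.det_conjTranspose, hWd]; simp
  · change g = W * D * (E * Wᴴ * g)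
    calc g = W * Wᴴ * g := by rw [hW1, Matrix.one_mul]
      _ = W * (D * E) * Wᴴ * g := by rw [hDE, Matrix.mul_one]
      _ = _ := by simp only [Matrix.mul_assoc]



theorem cartan_decomposition_SL2C (g : Matrix.SpecialLinearGroup (Fin 2) ℂ) :
    ∃ r : ℝ, 0 ≤ r ∧
      (∃ u v : Matrix (Fin 2) (Fin 2) ℂ,
        u ∈ Matrix.specialUnitaryGroup (Fin 2) ℂ ∧
        v ∈ Matrix.specialUnitaryGroup (Fin 2) ℂ ∧
        (g : Matrix (Fin 2) (Fin 2) ℂ) =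
          u * Matrix.diagonal ![(Real.exp (r / 2) : ℂ), (Real.exp (-r / 2) : ℂ)] * v) ∧
      (∀ r' : ℝ, 0 ≤ r' →
        (∃ u v : Matrix (Fin 2) (Fin 2) ℂ,
          u ∈ Matrix.specialUnitaryGroup (Fin 2) ℂ ∧
          v ∈ Matrix.specialUnitaryGroup (Fin 2) ℂ ∧
          (g : Matrix (Fin 2) (Fin 2) ℂ) =
            u * Matrix.diagonal ![(Real.exp (r' / 2) : ℂ), (Real.exp (-r' / 2) : ℂ)] * v) →
        r' = r) ∧
      Real.cosh r =
        (1 / 2) * (Matrix.trace ((g : Matrix (Fin 2) (Fin 2) ℂ) *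
          (g : Matrix (Fin 2) (Fin 2) ℂ)ᴴ)).re := by
  obtain ⟨r, hr, u, v, hu, hv, h⟩ := cartan_exists g.1 g.2
  have hc := cartan_cosh _ u v r hu hv h
  refine ⟨r, hr, ⟨u, v, hu, hv, h⟩, ?_, hc⟩
  rintro r' hr' ⟨u', v', hu', hv', h'⟩
  have hc' := cartan_cosh _ u' v' r' hu' hv' h'
  have e : Real.cosh r' = Real.cosh r := hc'.trans hc.symm
  have h1 := Real.cosh_le_cosh.1 e.le
  have h2 := Real.cosh_le_cosh.1 e.ge
  rw [abs_of_nonneg hr, abs_of_nonneg hr'] at h1 h2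
  exact le_antisymm h1 h2
end
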